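/- Fix integers k and ℓ with 1 ≤ k ≤ ℓ. Then the normalized volume σ_n(k,ℓ) of the rank-2 lattice path matroid polytope P_{M_n[k,ℓ]}, viewed as a function of n, agrees with a polynomial in n of degree ℓ for all n ≥ ℓ + 2. -/

import Mathlib

/-!
Statement 12: For fixed `1 ≤ k ≤ ℓ`, the normalized volume `σ_n(k,ℓ)` agrees, as a
function of `n`, with a polynomial in `n` of degree `ℓ` for all `n ≥ ℓ + 2`.
-/

open scoped Classical Pointwise

/-- The height of the lattice path associated to `A ⊆ [n]` after `i` steps:
the number of north steps (elements of `A`) among the first `i` steps. -/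
def pathHeight {n : ℕ} (A : Finset (Fin n)) (i : ℕ) : ℕ :=
  (A.filter fun j => j.val < i).card

/-- The 0/1 indicator vector of a subset of `[n]`. -/
def indVec {n : ℕ} (B : Finset (Fin n)) : Fin n → ℝ :=
  fun i => if i ∈ B then 1 else 0

/-- Height after `i` steps of the upper path `U` of `M_n[k,ℓ]`, which has north steps
at positions `1` and `n - ℓ`. -/
def upperHt (n l i : ℕ) : ℕ :=
  (if 1 ≤ i then 1 else 0) + (if n - l ≤ i then 1 else 0)

/-- Height after `i` steps of the lower path `L` of `M_n[k,ℓ]`, which has its two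
north steps at the end of the diagram (positions `n - k` and `n`). -/
def lowerHt (n k i : ℕ) : ℕ :=
  (if n - k ≤ i then 1 else 0) + (if n ≤ i then 1 else 0)

/-- The bases of the rank-2 lattice path matroid `M_n[k,ℓ]`: all `2`-subsets of `[n]`
whose lattice path lies weakly between the lower and upper paths. -/
noncomputable def MklBases (n k l : ℕ) : Finset (Finset (Fin n)) :=
  Finset.univ.filter fun B => B.card = 2 ∧
    ∀ i ∈ Finset.range (n + 1),
      lowerHt n k i ≤ pathHeight B i ∧ pathHeight B i ≤ upperHt n l i

/-- The matroid polytope of `M_n[k,ℓ]`. -/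
noncomputable def MklPolytope (n k l : ℕ) : Set (Fin n → ℝ) :=
  convexHull ℝ {x | ∃ B ∈ MklBases n k l, x = indVec B}

/-- The number of lattice (integer) points of a subset of `ℝⁿ`. -/
noncomputable def latticeCount {n : ℕ} (S : Set (Fin n → ℝ)) : ℕ :=
  Set.ncard {x ∈ S | ∀ i, ∃ m : ℤ, x i = (m : ℝ)}

/-- The normalized volume of a `d`-dimensional lattice polytope `P`: the `d`-th finite
difference at `0` of the Ehrhart counting function, i.e. `d! · vol(P)`. -/
noncomputable def normVol {n : ℕ} (P : Set (Fin n → ℝ)) (d : ℕ) : ℤ :=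
  ∑ j ∈ Finset.range (d + 1),
    (-1 : ℤ) ^ j * (d.choose j : ℤ) * (latticeCount (((d - j : ℕ) : ℝ) • P) : ℤ)

/-- `σ_n(k,ℓ)`: the normalized volume of the rank-2 lattice path matroid polytope
`P_{M_n[k,ℓ]}`, set to `0` when the parameters are out of range. -/
noncomputable def sigmaVol (n k l : ℕ) : ℤ :=
  if 1 ≤ k ∧ k ≤ l ∧ l ≤ n - 2 then normVol (MklPolytope n k l) (n - 1) else 0

section NormalizedVolume

open Finset Polynomial

theorem sum_antidiagonal_choose_mul_choose_add (q R t : ℕ) :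
    ∑ p ∈ antidiagonal t, p.1.choose q * (p.2 + R).choose R = (t + R + 1).choose (q + R + 1) := by
  induction R generalizing t with
  | zero =>
    rw [Finset.Nat.sum_antidiagonal_eq_sum_range_succ_mk]
    simp only [add_zero, Nat.choose_zero_right, mul_one]
    induction t with
    | zero => rcases q with _ | q <;> simp [Nat.choose_succ_succ']
    | succ t ih => rw [sum_range_succ, ih, Nat.choose_succ_succ' (t + 1), add_comm]
  | succ R ihR =>
    induction t with
    | zero =>
      rcases q with _ | q <;> simp
      exact (Nat.choose_eq_zero_of_lt (by lia)).symm
    | succ t iht =>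
      have h := ihR (t + 1)
      rw [Finset.Nat.antidiagonal_succ', sum_cons, sum_map] at h ⊢
      simp only [Function.Embedding.prodMap, Function.Embedding.coeFn_mk, Prod.map,
        Function.Embedding.refl_apply, Nat.succ_eq_add_one] at h ⊢
      have e : ∀ b : ℕ, (b + 1 + (R + 1)).choose (R + 1) =
          (b + (R + 1)).choose (R + 1) + (b + 1 + R).choose R := fun b => by
        rw [show b + 1 + (R + 1) = (b + R + 1) + 1 by ring, Nat.choose_succ_succ',
          show b + 1 + R = b + R + 1 by ring, add_comm, add_assoc b R 1]
      simp only [e, mul_add, sum_add_distrib, iht]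
      simp only [zero_add, Nat.choose_self, mul_one] at h ⊢
      have e2 := Nat.choose_succ_succ' (t + R + 2) (q + R + 1)
      rw [show t + 1 + (R + 1) + 1 = t + R + 2 + 1 by ring,
        show q + (R + 1) + 1 = q + R + 1 + 1 by ring, e2,
        show t + (R + 1) + 1 = t + R + 2 by ring]
      rw [show t + 1 + R + 1 = t + R + 2 by ring] at h
      omega

/-- `f` is given by a rational polynomial of degree at most `d` whose coefficient of degree `d`
is `c`. -/
def IsPolyWithCoeff (f : ℕ → ℚ) (d : ℕ) (c : ℚ) : Prop :=
  ∃ p : ℚ[X], p.natDegree ≤ d ∧ p.coeff d = c ∧ ∀ t : ℕ, f t = p.eval (t : ℚ)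

namespace IsPolyWithCoeff

variable {f g : ℕ → ℚ} {d e : ℕ} {a b : ℚ}

theorem sub (hf : IsPolyWithCoeff f d a) (hg : IsPolyWithCoeff g d b) :
    IsPolyWithCoeff (fun t => f t - g t) d (a - b) := by
  obtain ⟨p, hp, rfl, hfp⟩ := hf
  obtain ⟨q, hq, rfl, hgq⟩ := hg
  exact ⟨p - q, natDegree_sub_le_of_le hp hq |>.trans (by simp), by simp, fun t => by
    simp [hfp, hgq]⟩

theorem mul (hf : IsPolyWithCoeff f d a) (hg : IsPolyWithCoeff g e b) :
    IsPolyWithCoeff (fun t => f t * g t) (d + e) (a * b) := by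
  obtain ⟨p, hp, rfl, hfp⟩ := hf
  obtain ⟨q, hq, rfl, hgq⟩ := hg
  exact ⟨p * q, natDegree_mul_le_of_le hp hq, coeff_mul_add_eq_of_natDegree_le hp hq, fun t => by
    simp [hfp, hgq]⟩

theorem sum {ι : Type*} {s : Finset ι} {f : ι → ℕ → ℚ} {a : ι → ℚ}
    (h : ∀ i ∈ s, IsPolyWithCoeff (f i) d (a i)) :
    IsPolyWithCoeff (fun t => ∑ i ∈ s, f i t) d (∑ i ∈ s, a i) := by
  choose! p hp hc hf using h
  refine ⟨∑ i ∈ s, p i, natDegree_sum_le_of_forall_le _ _ hp, ?_, fun t => ?_⟩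
  · rw [finsetSum_coeff]
    exact sum_congr rfl hc
  · rw [eval_finsetSum]
    exact sum_congr rfl fun i hi => hf i hi t

theorem of_lt (hf : IsPolyWithCoeff f d a) (h : d < e) : IsPolyWithCoeff f e 0 := by
  obtain ⟨p, hp, -, hfp⟩ := hf
  exact ⟨p, by lia, coeff_eq_zero_of_natDegree_lt (by lia), hfp⟩

theorem choose (m b i : ℕ) :
    IsPolyWithCoeff (fun t => ((m * t + b).choose i : ℚ)) i ((m : ℚ) ^ i / i.factorial) := by
  have hd : (C (m : ℚ) * X + C (b : ℚ)).natDegree ≤ 1 := natDegree_linear_le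
  refine ⟨C ((i.factorial : ℚ)⁻¹) * (descPochhammer ℚ i).comp (C (m : ℚ) * X + C (b : ℚ)),
    ?_, ?_, fun t => ?_⟩
  · refine (natDegree_C_mul_le _ _).trans (natDegree_comp_le.trans ?_)
    rw [descPochhammer_natDegree]
    nlinarith
  · have := coeff_comp_degree_mul_degree (p := descPochhammer ℚ i) (q := C (m : ℚ) * X + C (b : ℚ))
    rcases eq_or_ne m 0 with rfl | hm
    · rcases i with _ | i
      · simp
      · simp [coeff_C_succ, comp_C, -map_natCast, -eval_natCast]
    · have h1 : (C (m : ℚ) * X + C (b : ℚ)).natDegree = 1 := natDegree_linear (by simpa)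
      rw [h1, descPochhammer_natDegree, mul_one] at this
      rw [coeff_C_mul, this (by simp), leadingCoeff_linear (by simpa),
        (monic_descPochhammer ℚ i).leadingCoeff]
      ring
  · dsimp only
    rw [Nat.cast_choose_eq_descPochhammer_div]
    simp
    ring

theorem alternating_sum (hf : IsPolyWithCoeff f d a) :
    ∑ j ∈ range (d + 1), (-1 : ℚ) ^ j * d.choose j * f (d - j) = a * d.factorial := by
  obtain ⟨p, hp, rfl, hfp⟩ := hf
  have h : (fwdDiff (1 : ℚ))^[d] p.eval 0 = p.coeff d * d.factorial := by
    rcases hp.lt_or_eq with h | rfl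
    · simp [fwdDiff_iter_eq_zero_of_degree_lt h, coeff_eq_zero_of_natDegree_lt h]
    · simp [fwdDiff_iter_degree_eq_factorial]
  rw [← h, fwdDiff_iter_eq_sum_shift, ← sum_range_reflect]
  refine sum_congr rfl fun j hj => ?_
  have hj : j ≤ d := by simpa [Nat.lt_succ_iff] using hj
  simp [hfp, Nat.sub_sub_self hj, Nat.choose_symm hj]

end IsPolyWithCoeff

section LatticePointCount

variable {ι : Type*} [DecidableEq ι]

theorem card_piAntidiag_nat (s : Finset ι) (N : ℕ) :
    (s.piAntidiag N).card = (s.card + N - 1).choose N := by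
  rw [← card_finsuppAntidiag_nat_eq_choose]
  refine (card_bij (fun (f : ι →₀ ℕ) _ => ⇑f) (fun f hf => ?_)
    (fun f _ g _ h => DFunLike.coe_injective h)
    fun f hf => ?_).symm
  · rw [mem_finsuppAntidiag] at hf
    exact mem_piAntidiag.2 ⟨hf.1, fun i hi => hf.2 (Finsupp.mem_support_iff.2 hi)⟩
  · rw [mem_piAntidiag] at hf
    exact ⟨Finsupp.onFinset s f hf.2, mem_finsuppAntidiag.2
      ⟨by simpa using hf.1, Finsupp.support_onFinset_subset⟩, by simp⟩

theorem card_piAntidiag_of_card_eq_succ {s : Finset ι} {a : ℕ} (hs : s.card = a + 1) (N : ℕ) :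
    (s.piAntidiag N).card = (N + a).choose a := by
  rw [card_piAntidiag_nat, hs, show a + 1 + N - 1 = a + N by lia, add_comm a,
    Nat.choose_symm_add]

variable [Fintype ι]

theorem card_filter_sum_eq_and_sum_compl_eq (s : Finset ι) (N a b : ℕ) (h : a + b = N) :
    ((piAntidiag univ N).filter fun x : ι → ℕ => ∑ i ∈ sᶜ, x i = b).card =
      (s.piAntidiag a).card * (sᶜ.piAntidiag b).card := by
  subst h
  rw [← card_product]
  refine card_bij'
    (fun x _ => (fun i => if i ∈ s then x i else 0, fun i => if i ∈ s then 0 else x i))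
    (fun p _ => p.1 + p.2) ?_ ?_ ?_ ?_
  · intro x hx
    simp only [mem_filter, mem_piAntidiag, mem_univ, implies_true, and_true] at hx
    have h1 := sum_add_sum_compl s x
    have h2 : ∑ i ∈ sᶜ, (if i ∈ s then 0 else x i) = ∑ i ∈ sᶜ, x i :=
      sum_congr rfl fun i hi => if_neg (mem_compl.1 hi)
    have h3 : ∑ i ∈ s, (if i ∈ s then x i else 0) = ∑ i ∈ s, x i :=
      sum_congr rfl fun i hi => if_pos hi
    simp only [mem_product, mem_piAntidiag, h2, h3]
    refine ⟨⟨by lia, fun i hi => ?_⟩, by lia, fun i hi => ?_⟩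
    · by_contra h; simp [h] at hi
    · simp at hi ⊢; exact hi.1
  · rintro ⟨y, z⟩ h
    simp only [mem_product, mem_piAntidiag] at h
    have hy : ∑ i ∈ sᶜ, y i = 0 := sum_eq_zero fun i hi => by
      by_contra h'; exact (mem_compl.1 hi) (h.1.2 i h')
    have hz : ∑ i ∈ s, z i = 0 := sum_eq_zero fun i hi => by
      by_contra h'; exact (mem_compl.1 (h.2.2 i h')) hi
    simp only [mem_filter, mem_piAntidiag, mem_univ, implies_true, and_true, Pi.add_apply,
      sum_add_distrib, hy, h.2.1, zero_add, ← sum_add_sum_compl s, hz, h.1.1, add_zero]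
  · intro x _
    ext i
    by_cases h : i ∈ s <;> simp [h]
  · rintro ⟨y, z⟩ h
    simp only [mem_product, mem_piAntidiag, mem_compl] at h
    have h1 := h.1.2
    have h2 := h.2.2
    ext i <;> simp only [Pi.add_apply] <;> grind

/-- The number of nonnegative integer points of total `2 t` whose coordinates in `s` sum to more
than `t`. -/
theorem card_filter_lt_sum (s : Finset ι) {a b : ℕ} (hs : s.card = a + 1)
    (hs' : sᶜ.card = b + 1) (t : ℕ) :
    ((piAntidiag univ (2 * t)).filter fun x : ι → ℕ => t < ∑ i ∈ s, x i).card =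
      ∑ v ∈ range t, (2 * t - v + a).choose a * (v + b).choose b := by
  rw [card_eq_sum_card_fiberwise (f := fun x => ∑ i ∈ sᶜ, x i) (t := range t)]
  · refine sum_congr rfl fun v hv => ?_
    have hv := mem_range.1 hv
    rw [← card_piAntidiag_of_card_eq_succ hs, ← card_piAntidiag_of_card_eq_succ hs',
      ← card_filter_sum_eq_and_sum_compl_eq s (2 * t) _ v (by lia), filter_filter]
    congr 1
    refine filter_congr fun x hx => ?_
    have h1 := sum_add_sum_compl s x
    have h2 : ∑ i, x i = 2 * t := (mem_piAntidiag.1 hx).1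
    lia
  · intro x hx
    simp only [coe_filter, mem_piAntidiag, Set.mem_ofPred_eq] at hx
    have h1 := sum_add_sum_compl s x
    simp only [coe_range, Set.mem_Iio]
    have h2 : ∑ i, x i = 2 * t := hx.1.1
    lia

theorem isPolyWithCoeff_card_filter_lt_sum (s : Finset ι) {d : ℕ} (hd : Fintype.card ι = d + 1)
    (hs : s.card ≤ d) :
    IsPolyWithCoeff (fun t => (((piAntidiag univ (2 * t)).filter
      fun x : ι → ℕ => t < ∑ i ∈ s, x i).card : ℚ)) d
      (∑ i ∈ range s.card, (d.choose i : ℚ) / d.factorial) := by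
  rcases Nat.eq_zero_or_pos s.card with h0 | h0
  · rw [card_eq_zero] at h0
    subst h0
    exact ⟨0, by simp⟩
  obtain ⟨a, ha⟩ : ∃ a, s.card = a + 1 := ⟨s.card - 1, by lia⟩
  obtain ⟨b, rfl⟩ : ∃ b, d = a + b + 1 := ⟨d - (a + 1), by lia⟩
  have hb : sᶜ.card = b + 1 := by rw [card_compl]; lia
  have key : ∀ t : ℕ, (((piAntidiag univ (2 * t)).filter
      fun x : ι → ℕ => t < ∑ i ∈ s, x i).card : ℚ) =
      ∑ p ∈ antidiagonal a, ((1 * t + a).choose p.1 : ℚ) * ((1 * t + (b + 1)).choose (p.2 + b + 1)) -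
        ((1 * t + a).choose a : ℚ) * (1 * t + b).choose b := by
    intro t
    rw [card_filter_lt_sum s ha hb, eq_sub_iff_add_eq]
    norm_cast
    simp only [one_mul]
    have h1 : ∑ v ∈ range t, (2 * t - v + a).choose a * (v + b).choose b +
        (t + a).choose a * (t + b).choose b =
        ∑ v ∈ range (t + 1), (t - v + (t + a)).choose a * (v + b).choose b := by
      rw [sum_range_succ]
      congr 1
      · refine sum_congr rfl fun v hv => ?_
        have hv := mem_range.1 hv
        rw [show 2 * t - v + a = t - v + (t + a) by lia]
      · simp
    have h2 := Finset.Nat.sum_antidiagonal_eq_sum_range_succ_mk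
      (fun p : ℕ × ℕ => (p.2 + (t + a)).choose a * (p.1 + b).choose b) t
    rw [h1, ← h2, ← Finset.Nat.sum_antidiagonal_swap]
    simp only [Prod.fst_swap, Prod.snd_swap]
    have h3 : ∀ u, (u + (t + a)).choose a =
        ∑ p ∈ antidiagonal a, (t + a).choose p.1 * u.choose p.2 := fun u => by
      rw [add_comm, Nat.add_choose_eq]
    simp only [h3, sum_mul]
    rw [sum_comm]
    refine sum_congr rfl fun p _ => ?_
    simp only [mul_assoc]
    rw [← mul_sum, sum_antidiagonal_choose_mul_choose_add, add_assoc]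
  simp only [key]
  have h1 : IsPolyWithCoeff (fun t => ∑ p ∈ antidiagonal a, ((1 * t + a).choose p.1 : ℚ) *
      ((1 * t + (b + 1)).choose (p.2 + b + 1))) (a + b + 1)
      (∑ p ∈ antidiagonal a, (((1 : ℕ) : ℚ) ^ p.1 / p.1.factorial) *
        (((1 : ℕ) : ℚ) ^ (p.2 + b + 1) / (p.2 + b + 1).factorial)) := by
    refine .sum fun p hp => ?_
    rw [← mem_antidiagonal.1 hp, show p.1 + p.2 + b + 1 = p.1 + (p.2 + b + 1) by ring]
    exact (IsPolyWithCoeff.choose 1 _ _).mul (.choose 1 _ _)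
  have h2 := ((IsPolyWithCoeff.choose 1 a a).mul (.choose 1 b b)).of_lt (Nat.lt_succ_self _)
  convert h1.sub h2 using 1
  rw [sub_zero, ha, Finset.Nat.sum_antidiagonal_eq_sum_range_succ_mk]
  refine sum_congr rfl fun i hi => ?_
  have hi := mem_range.1 hi
  rw [Nat.cast_choose ℚ (by lia), show a - i + b + 1 = a + b + 1 - i by lia]
  have := Nat.factorial_ne_zero (a + b + 1)
  field_simp
  simp

theorem isPolyWithCoeff_card_piAntidiag {d : ℕ} (hd : Fintype.card ι = d + 1) :
    IsPolyWithCoeff (fun t => ((piAntidiag (univ : Finset ι) (2 * t)).card : ℚ)) d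
      (2 ^ d / d.factorial) := by
  simp only [card_piAntidiag_of_card_eq_succ (card_univ.trans hd)]
  exact IsPolyWithCoeff.choose 2 d d

/-- The nonnegative integer points of total `2 t` whose sum over each fibre of `c` is at most
`t`. -/
def boundedPoints (c : ι → ℕ) (t : ℕ) : Finset (ι → ℕ) :=
  (piAntidiag univ (2 * t)).filter fun x => ∀ i, ∑ j with c j = c i, x j ≤ t

theorem mem_boundedPoints {c : ι → ℕ} {t : ℕ} {x : ι → ℕ} :
    x ∈ boundedPoints c t ↔ ∑ i, x i = 2 * t ∧ ∀ i, ∑ j with c j = c i, x j ≤ t := by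
  simp [boundedPoints]

theorem card_boundedPoints_add {c : ι → ℕ} {K : ℕ} (hc : ∀ i, c i < K) (t : ℕ) :
    (boundedPoints c t).card + ∑ m ∈ range K, ((piAntidiag univ (2 * t)).filter
      fun x : ι → ℕ => t < ∑ i with c i = m, x i).card =
      (piAntidiag (univ : Finset ι) (2 * t)).card := by
  rw [← card_biUnion, ← card_filter_add_card_filter_not (s := piAntidiag univ (2 * t))
    (fun x : ι → ℕ => ∀ i, ∑ j with c j = c i, x j ≤ t), boundedPoints]
  · congr 2
    ext x
    simp only [mem_biUnion, mem_range, mem_filter, not_forall, not_le]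
    constructor
    · rintro ⟨m, -, hx, hm⟩
      obtain ⟨i, hi⟩ : (univ.filter fun i => c i = m).Nonempty := by
        rw [nonempty_iff_ne_empty]
        intro h
        simp [h] at hm
      exact ⟨hx, i, by rwa [(mem_filter.1 hi).2]⟩
    · rintro ⟨hx, i, hi⟩
      exact ⟨c i, hc i, hx, hi⟩
  · intro m _ m' _ hmm
    rw [Function.onFun, disjoint_left]
    intro x hx hx'
    simp only [mem_filter, mem_piAntidiag] at hx hx'
    have h1 : Disjoint (univ.filter fun i => c i = m) (univ.filter fun i => c i = m') :=
      disjoint_filter.2 fun i _ h h' => hmm (h.symm.trans h')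
    have h2 := sum_union h1 (f := x)
    have h3 := sum_le_univ_sum_of_nonneg (f := x) (fun i => Nat.zero_le _)
      (s := (univ.filter fun i => c i = m) ∪ (univ.filter fun i => c i = m'))
    have h4 : ∑ i, x i = 2 * t := hx.1.1
    lia

theorem isPolyWithCoeff_card_boundedPoints {c : ι → ℕ} {K d : ℕ} (hc : ∀ i, c i < K)
    (hd : Fintype.card ι = d + 1) (hne : ∀ m, ∃ i, c i ≠ m) :
    IsPolyWithCoeff (fun t => ((boundedPoints c t).card : ℚ)) d
      (2 ^ d / d.factorial - ∑ m ∈ range K,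
        ∑ i ∈ range (univ.filter fun j => c j = m).card, (d.choose i : ℚ) / d.factorial) := by
  have h : ∀ t, ((boundedPoints c t).card : ℚ) = (piAntidiag (univ : Finset ι) (2 * t)).card -
      ∑ m ∈ range K, (((piAntidiag univ (2 * t)).filter
        fun x : ι → ℕ => t < ∑ i with c i = m, x i).card : ℚ) := fun t => by
    rw [← card_boundedPoints_add hc t]
    push_cast
    ring
  simp only [h]
  refine (isPolyWithCoeff_card_piAntidiag hd).sub (.sum fun m _ => ?_)
  refine isPolyWithCoeff_card_filter_lt_sum _ hd ?_
  obtain ⟨i, hi⟩ := hne m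
  have := card_lt_univ_of_notMem (s := univ.filter fun j => c j = m) (x := i) (by simpa using hi)
  lia

end LatticePointCount

section Ehrhart

variable {n : ℕ}

/-- The convex hull of the indicator vectors of the pairs meeting two distinct fibres of `c`, that
is, the base polytope of the rank-two matroid whose parallel classes are the fibres of `c`. -/
def pairPolytope (c : Fin n → ℕ) : Set (Fin n → ℝ) :=
  convexHull ℝ {x | ∃ i j, c i ≠ c j ∧ x = indVec {i, j}}

theorem sum_indVec_pair {i j : Fin n} (hij : i ≠ j) (s : Finset (Fin n)) :
    ∑ a ∈ s, indVec {i, j} a = (if i ∈ s then 1 else 0) + (if j ∈ s then 1 else 0) := by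
  have h : ∀ a, indVec {i, j} a = (if a = i then 1 else 0) + (if a = j then 1 else 0) := by
    intro a
    unfold indVec
    by_cases h1 : a = i
    · subst h1; simp [hij]
    · simp [h1]
  simp [h, sum_add_distrib]

theorem pairPolytope_subset (c : Fin n → ℕ) :
    pairPolytope c ⊆ {x | (∀ i, 0 ≤ x i) ∧ ∑ i, x i = 2 ∧ ∀ i, ∑ j with c j = c i, x j ≤ 1} := by
  refine convexHull_min ?_ ?_
  · rintro x ⟨i, j, hij, rfl⟩
    have hne : i ≠ j := fun h => hij (congrArg c h)
    refine ⟨fun a => ?_, ?_, fun a => ?_⟩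
    · unfold indVec; split_ifs <;> norm_num
    · rw [sum_indVec_pair hne]; norm_num
    · rw [sum_indVec_pair hne]
      simp only [mem_filter, mem_univ, true_and]
      split_ifs with h1 h2
      · exact absurd (h1.trans h2.symm) hij
      all_goals norm_num
  · intro x hx y hy a b ha hb hab
    refine ⟨fun i => ?_, ?_, fun i => ?_⟩
    · have := hx.1 i
      have := hy.1 i
      simp only [Pi.add_apply, Pi.smul_apply, smul_eq_mul]
      positivity
    · simp only [Pi.add_apply, Pi.smul_apply, smul_eq_mul, sum_add_distrib, ← mul_sum, hx.2.1,
        hy.2.1]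
      linarith
    · have h1 := mul_le_mul_of_nonneg_left (hx.2.2 i) ha
      have h2 := mul_le_mul_of_nonneg_left (hy.2.2 i) hb
      simp only [Pi.add_apply, Pi.smul_apply, smul_eq_mul, sum_add_distrib, ← mul_sum]
      linarith

/-- A nonzero bounded point stays bounded after removing the indicator of a suitable pair. -/
theorem exists_sub_pair_mem_boundedPoints {c : Fin n → ℕ} {t : ℕ} {x : Fin n → ℕ}
    (hx : x ∈ boundedPoints c (t + 1)) :
    ∃ i j, c i ≠ c j ∧ ∃ y ∈ boundedPoints c t,
      x = y + fun a => if a ∈ ({i, j} : Finset (Fin n)) then 1 else 0 := by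
  rw [mem_boundedPoints] at hx
  obtain ⟨hsum, hle⟩ := hx
  let S : ℕ → ℕ := fun m => ∑ j with c j = m, x j
  have hS : ∀ m, S m = ∑ j with c j = m, x j := fun _ => rfl
  have hle' : ∀ i, S (c i) ≤ t + 1 := hle
  have hpos : ∀ s : Finset (Fin n), 0 < ∑ a ∈ s, x a → ∃ a ∈ s, 0 < x a := fun s hs => by
    by_contra! h
    rw [sum_eq_zero fun a ha => Nat.le_zero.1 (h a ha)] at hs
    exact hs.false
  have hpos1 : (univ.filter fun a => 0 < x a).Nonempty := by
    obtain ⟨a, -, ha⟩ := hpos univ (by lia)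
    exact ⟨a, by simpa⟩
  obtain ⟨i, hi, himax⟩ := exists_max_image _ (fun a => S (c a)) hpos1
  have hsplit := sum_filter_add_sum_filter_not univ (fun a => c a = c i) x
  have hpos2 : (univ.filter fun a => 0 < x a ∧ c a ≠ c i).Nonempty := by
    obtain ⟨a, ha, ha'⟩ := hpos (univ.filter fun a => ¬ c a = c i) (by have := hle i; lia)
    exact ⟨a, by simpa using ⟨ha', (mem_filter.1 ha).2⟩⟩
  obtain ⟨j, hj, hjmax⟩ := exists_max_image _ (fun a => S (c a)) hpos2
  simp only [mem_filter, mem_univ, true_and] at hi hj himax hjmax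
  have hij : i ≠ j := fun h => hj.2 (congrArg c h.symm)
  let e : Fin n → ℕ := fun a => if a ∈ ({i, j} : Finset (Fin n)) then 1 else 0
  have he : ∀ s : Finset (Fin n), ∑ a ∈ s, e a =
      (if i ∈ s then 1 else 0) + if j ∈ s then 1 else 0 := by
    intro s
    have := sum_indVec_pair hij s
    simp only [indVec] at this
    exact_mod_cast this
  have hxe : x = (fun a => x a - e a) + e := by
    ext a
    have : e a ≤ x a := by
      simp only [e, mem_insert, mem_singleton]
      split_ifs with h
      · rcases h with rfl | rfl <;> lia
      · lia
    simp only [Pi.add_apply]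
    lia
  refine ⟨i, j, hj.2.symm, fun a => x a - e a, ?_, hxe⟩
  have hy : ∀ s : Finset (Fin n), ∑ a ∈ s, (x a - e a) +
      ((if i ∈ s then 1 else 0) + if j ∈ s then 1 else 0) = ∑ a ∈ s, x a := fun s => by
    rw [← he, ← sum_add_distrib]
    exact sum_congr rfl fun a _ => (congrFun hxe a).symm
  rw [mem_boundedPoints]
  constructor
  · have := hy univ
    simp only [mem_univ, if_true] at this
    lia
  · intro a
    have h1 := hy (univ.filter fun b => c b = c a)
    have h2 := hle a
    simp only [mem_filter, mem_univ, true_and] at h1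
    by_cases hai : c i = c a
    · rw [if_pos hai] at h1; lia
    by_cases haj : c j = c a
    · rw [if_pos haj] at h1; lia
    by_contra! hlt
    have h3 : S (c a) = t + 1 := by rw [hS]; lia
    obtain ⟨b, hb, hb'⟩ := hpos (univ.filter fun b => c b = c a) (by lia)
    have hb := (mem_filter.1 hb).2
    have h4 := hjmax b ⟨hb', by rw [hb]; exact fun h => hai h.symm⟩
    have h5 := himax j hj.1
    rw [hb] at h4
    have h6 : Disjoint (univ.filter fun b => c b = c i) (univ.filter fun b => c b = c j) :=
      disjoint_filter.2 fun b _ h h' => hj.2 (h'.symm.trans h)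
    have h7 : Disjoint ((univ.filter fun b => c b = c i) ∪ (univ.filter fun b => c b = c j))
        (univ.filter fun b => c b = c a) := by
      rw [disjoint_union_left]
      exact ⟨disjoint_filter.2 fun b _ h h' => hai (h.symm.trans h'),
        disjoint_filter.2 fun b _ h h' => haj (h.symm.trans h')⟩
    have h8 := sum_union h7 (f := x)
    rw [sum_union h6, ← hS, ← hS, ← hS] at h8
    have h9 := sum_le_univ_sum_of_nonneg (f := x) (fun i => Nat.zero_le _)
      (s := (univ.filter fun b => c b = c i) ∪ (univ.filter fun b => c b = c j) ∪
        (univ.filter fun b => c b = c a))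
    lia

theorem cast_mem_smul_pairPolytope {c : Fin n → ℕ} (hne : ∃ i j, c i ≠ c j) {t : ℕ}
    {x : Fin n → ℕ} (hx : x ∈ boundedPoints c t) :
    (fun i => (x i : ℝ)) ∈ (t : ℝ) • pairPolytope c := by
  induction t generalizing x with
  | zero =>
    obtain ⟨i, j, hij⟩ := hne
    have h : (pairPolytope c).Nonempty := ⟨_, subset_convexHull ℝ _ ⟨i, j, hij, rfl⟩⟩
    rw [Nat.cast_zero, Set.zero_smul_set h, Set.mem_zero]
    rw [mem_boundedPoints] at hx
    ext a
    simpa using (sum_eq_zero_iff.1 (hx.1.trans (mul_zero 2))) a (mem_univ a)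
  | succ t ih =>
    obtain ⟨i, j, hij, y, hy, rfl⟩ := exists_sub_pair_mem_boundedPoints hx
    have hconv : Convex ℝ (pairPolytope c) := convex_convexHull ℝ _
    rw [Nat.cast_succ, hconv.add_smul t.cast_nonneg zero_le_one, one_smul]
    refine ⟨_, ih hy, indVec {i, j}, subset_convexHull ℝ _ ⟨i, j, hij, rfl⟩, ?_⟩
    ext a
    simp [indVec]

theorem latticeCount_smul_pairPolytope {c : Fin n → ℕ} (hne : ∃ i j, c i ≠ c j) (t : ℕ) :
    latticeCount ((t : ℝ) • pairPolytope c) = (boundedPoints c t).card := by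
  have hinj : Function.Injective fun (x : Fin n → ℕ) i => (x i : ℝ) := fun x y h => by
    ext i
    exact Nat.cast_injective (congrFun h i)
  rw [latticeCount, ← Set.ncard_coe_finset, ← Set.ncard_image_of_injective _ hinj]
  congr 1
  ext z
  constructor
  · rintro ⟨⟨w, hw, rfl⟩, hz⟩
    obtain ⟨h0, h2, h1⟩ := pairPolytope_subset c hw
    choose m hm using hz
    have hm0 : ∀ i, 0 ≤ m i := fun i => by
      have h3 : (0 : ℝ) ≤ (m i : ℝ) := by
        rw [← hm i]
        exact mul_nonneg t.cast_nonneg (h0 i)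
      exact_mod_cast h3
    have hmt : ∀ i, (((m i).toNat : ℕ) : ℝ) = t * w i := fun i => by
      refine Eq.trans ?_ (hm i).symm
      exact_mod_cast Int.toNat_of_nonneg (hm0 i)
    refine ⟨fun i => (m i).toNat, ?_, funext hmt⟩
    rw [mem_coe, mem_boundedPoints]
    constructor
    · have : ((∑ i, (m i).toNat : ℕ) : ℝ) = (2 * t : ℕ) := by
        push_cast
        simp only [hmt, ← mul_sum, h2]
        ring
      exact_mod_cast this
    · intro i
      have : ((∑ j with c j = c i, (m j).toNat : ℕ) : ℝ) ≤ t := by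
        rw [Nat.cast_sum]
        simp only [hmt, ← mul_sum]
        nlinarith [h1 i, t.cast_nonneg (α := ℝ)]
      exact_mod_cast this
  · rintro ⟨x, hx, rfl⟩
    exact ⟨cast_mem_smul_pairPolytope hne hx, fun i => ⟨x i, by simp⟩⟩

theorem normVol_pairPolytope {c : Fin n → ℕ} {K d : ℕ} (hn : n = d + 1) (hc : ∀ i, c i < K)
    (hne : ∀ m, ∃ i, c i ≠ m) :
    (normVol (pairPolytope c) d : ℚ) = 2 ^ d - ∑ m ∈ range K,
        ∑ i ∈ range (univ.filter fun j => c j = m).card, (d.choose i : ℚ) := by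
  have h := (isPolyWithCoeff_card_boundedPoints hc (by simpa using hn) hne).alternating_sum
  have hf : (d.factorial : ℚ) ≠ 0 := by exact_mod_cast d.factorial_ne_zero
  simp only [← sum_div, ← sub_div, div_mul_cancel₀ _ hf] at h
  rw [← h, normVol]
  push_cast
  refine sum_congr rfl fun j _ => ?_
  obtain ⟨i, hi⟩ := hne (c ⟨0, by lia⟩)
  rw [latticeCount_smul_pairPolytope ⟨i, _, hi⟩]

end Ehrhart

section LatticePathMatroid

/-- The bases of `M_n[k,ℓ]` are the pairs of elements in different parallel classes, where the
parallel classes are the first `n - ℓ - 1` elements, the last `k` elements and the remaining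
singletons. -/
theorem mem_MklBases_iff {n k l : ℕ} (hk : 1 ≤ k) (hkl : k ≤ l) (hl : l + 2 ≤ n)
    (B : Finset (Fin n)) :
    B ∈ MklBases n k l ↔ ∃ i j : Fin n, min (i.val - (n - l - 2)) (l - k + 2) ≠
      min (j.val - (n - l - 2)) (l - k + 2) ∧ B = {i, j} := by
  have key : ∀ i j : Fin n, i < j → ({i, j} ∈ MklBases n k l ↔
      min (i.val - (n - l - 2)) (l - k + 2) ≠ min (j.val - (n - l - 2)) (l - k + 2)) := by
    intro i j hij
    have hlt : i.val < j.val := hij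
    have hh : ∀ m, pathHeight {i, j} m =
        (if i.val < m then 1 else 0) + if j.val < m then 1 else 0 := by
      intro m
      rw [pathHeight, filter_insert, filter_singleton]
      split_ifs <;> simp [hij.ne]
    simp only [MklBases, mem_filter, mem_univ, true_and, card_pair hij.ne, mem_range, hh, lowerHt,
      upperHt]
    have hj := j.isLt
    have hc : min (i.val - (n - l - 2)) (l - k + 2) ≠ min (j.val - (n - l - 2)) (l - k + 2) ↔
        i.val < n - k ∧ n - l - 1 ≤ j.val := by omega
    rw [hc]
    constructor
    · intro h
      have h1 := (h (n - k) (by lia)).1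
      have h2 := (h (n - l - 1) (by lia)).2
      rw [if_pos le_rfl] at h1
      rw [if_neg (show ¬ n - l ≤ n - l - 1 by lia)] at h2
      constructor
      · by_contra h3
        rw [if_neg h3, if_neg (show ¬ j.val < n - k by lia)] at h1
        lia
      · by_contra h3
        rw [if_pos (show j.val < n - l - 1 by lia), if_pos (show i.val < n - l - 1 by lia)] at h2
        split_ifs at h2 <;> lia
    · rintro ⟨h1, h2⟩ m hm
      constructor
      · rcases lt_or_ge m n with h3 | h3
        · rw [if_neg h3.not_ge]
          split_ifs <;> lia
        · rw [if_pos (show i.val < m by lia), if_pos (show j.val < m by lia)]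
          split_ifs <;> lia
      · refine add_le_add ?_ ?_ <;> split_ifs <;> lia
  constructor
  · intro hB
    have hcard : B.card = 2 := by
      simp only [MklBases, mem_filter] at hB
      exact hB.2.1
    obtain ⟨i, j, hij, rfl⟩ := card_eq_two.1 hcard
    rcases hij.lt_or_gt with h | h
    · exact ⟨i, j, (key i j h).1 hB, rfl⟩
    · rw [pair_comm] at hB
      exact ⟨j, i, (key j i h).1 hB, pair_comm _ _⟩
  · rintro ⟨i, j, hij, rfl⟩
    rcases lt_trichotomy i j with h | rfl | h
    · exact (key i j h).2 hij
    · exact absurd rfl hij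
    · rw [pair_comm]
      exact (key j i h).2 hij.symm

theorem Fin.card_filter_val_of_iff_Ico {n a b : ℕ} {P : ℕ → Prop} [DecidablePred P] (hb : b ≤ n)
    (h : ∀ i < n, P i ↔ a ≤ i ∧ i < b) : (univ.filter fun i : Fin n => P i).card = b - a := by
  rw [← Nat.card_Ico, ← card_map Fin.valEmbedding]
  congr 1
  ext i
  simp only [mem_map, mem_filter, mem_univ, true_and, Fin.valEmbedding_apply, mem_Ico]
  constructor
  · rintro ⟨j, hj, rfl⟩
    exact (h j j.isLt).1 hj
  · intro hi
    exact ⟨⟨i, by lia⟩, (h i (by lia)).2 hi, rfl⟩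

theorem Nat.sum_range_choose_upper {d l : ℕ} (h : l ≤ d) :
    ∑ i ∈ range (d - l), d.choose i + ∑ i ∈ range (l + 1), d.choose i = 2 ^ d := by
  rw [← Nat.sum_range_choose, show d + 1 = (d - l) + (l + 1) by lia,
    sum_range_add _ (d - l) (l + 1), ← sum_range_reflect _ (l + 1)]
  congr 1
  refine sum_congr rfl fun i hi => ?_
  have hi := mem_range.1 hi
  rw [← Nat.choose_symm (by lia)]
  congr 1
  lia

theorem sigmaVol_eq {n k l d : ℕ} (hk : 1 ≤ k) (hkl : k ≤ l) (hl : l + 2 ≤ n) (hn : n = d + 1) :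
    (sigmaVol n k l : ℚ) = ∑ j ∈ Icc k l, (d.choose j : ℚ) - (l - k + 1 : ℕ) := by
  let c : Fin n → ℕ := fun i => min (i.val - (n - l - 2)) (l - k + 2)
  have hP : MklPolytope n k l = pairPolytope c := by
    rw [MklPolytope, pairPolytope]
    congr 1
    ext x
    constructor
    · rintro ⟨B, hB, rfl⟩
      obtain ⟨i, j, hij, rfl⟩ := (mem_MklBases_iff hk hkl hl B).1 hB
      exact ⟨i, j, hij, rfl⟩
    · rintro ⟨i, j, hij, rfl⟩
      exact ⟨_, (mem_MklBases_iff hk hkl hl _).2 ⟨i, j, hij, rfl⟩, rfl⟩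
  have hc : ∀ i, c i < l - k + 1 + 1 + 1 := fun i => by simp only [c]; lia
  have hne : ∀ m, ∃ i, c i ≠ m := fun m => by
    rcases m with _ | m
    · exact ⟨⟨n - 1, by lia⟩, by simp only [c]; lia⟩
    · exact ⟨⟨0, by lia⟩, by simp only [c]; lia⟩
  have h0 : (univ.filter fun j => c j = 0).card = d - l := by
    rw [Fin.card_filter_val_of_iff_Ico (P := fun i => min (i - (n - l - 2)) (l - k + 2) = 0)
      (a := 0) (b := d - l) (by lia) (by lia), Nat.sub_zero]
  have h1 : ∀ m ∈ range (l - k + 1), (univ.filter fun j => c j = m + 1).card = 1 := fun m hm => by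
    have hm := mem_range.1 hm
    rw [Fin.card_filter_val_of_iff_Ico (P := fun i => min (i - (n - l - 2)) (l - k + 2) = m + 1)
      (a := n - l - 2 + m + 1) (b := n - l - 2 + m + 2) (by lia) (by lia)]
    lia
  have h2 : (univ.filter fun j => c j = l - k + 1 + 1).card = k := by
    rw [Fin.card_filter_val_of_iff_Ico (P := fun i => min (i - (n - l - 2)) (l - k + 2) =
      l - k + 1 + 1) (a := n - k) (b := n) (by lia) (by lia)]
    lia
  rw [sigmaVol, if_pos ⟨hk, hkl, by lia⟩, hP, show n - 1 = d by lia,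
    normVol_pairPolytope hn hc hne, sum_range_succ, sum_range_succ', h0, h2,
    sum_congr rfl fun m hm => by rw [h1 m hm]]
  have hpow : ∑ i ∈ range (d - l), (d.choose i : ℚ) + ∑ i ∈ range (l + 1), (d.choose i : ℚ) =
      2 ^ d := by
    exact_mod_cast Nat.sum_range_choose_upper (show l ≤ d by lia)
  have hIcc := sum_range_add_sum_Ico (fun i => (d.choose i : ℚ)) (show k ≤ l + 1 by lia)
  rw [Ico_add_one_right_eq_Icc] at hIcc
  rw [← hpow, ← hIcc]
  simp
  ring

theorem isPolyWithCoeff_sum_choose_sub {k l : ℕ} (hk : 1 ≤ k) (hkl : k ≤ l) :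
    IsPolyWithCoeff (fun d => ∑ j ∈ Icc k l, (d.choose j : ℚ) - (l - k + 1 : ℕ)) l
      (1 / l.factorial) := by
  have h1 : IsPolyWithCoeff (fun _ => ((l - k + 1 : ℕ) : ℚ)) l 0 :=
    IsPolyWithCoeff.of_lt (d := 0) ⟨C ((l - k + 1 : ℕ) : ℚ), (natDegree_C _).le, rfl, by simp⟩
      (by lia)
  have h2 : IsPolyWithCoeff (fun d => ∑ j ∈ Icc k l, (d.choose j : ℚ)) l
      (∑ j ∈ Icc k l, if j = l then 1 / (l.factorial : ℚ) else 0) := by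
    refine .sum fun j hj => ?_
    have h := IsPolyWithCoeff.choose 1 0 j
    simp only [one_mul, add_zero, Nat.cast_one, one_pow] at h
    split_ifs with hjl
    · rwa [hjl] at h ⊢
    · exact h.of_lt (lt_of_le_of_ne (mem_Icc.1 hj).2 hjl)
  rw [sum_ite_eq', if_pos (right_mem_Icc.2 hkl)] at h2
  simpa using h2.sub h1

end LatticePathMatroid

end NormalizedVolume

/-- For fixed `1 ≤ k ≤ ℓ`, the function `n ↦ σ_n(k,ℓ)` agrees with a
polynomial of degree `ℓ` for all `n ≥ ℓ + 2`. -/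
theorem sigma_polynomial (k l : ℕ) (hk : 1 ≤ k) (hkl : k ≤ l) :
    ∃ p : Polynomial ℚ, p.degree = (l : WithBot ℕ) ∧
      ∀ n : ℕ, l + 2 ≤ n → (sigmaVol n k l : ℚ) = p.eval (n : ℚ) := by
  obtain ⟨p, hp, hc, hpe⟩ := isPolyWithCoeff_sum_choose_sub hk hkl
  have hpl : p.natDegree = l := hp.antisymm <| Polynomial.le_natDegree_of_ne_zero <| by
    rw [hc]
    have := l.factorial_ne_zero
    positivity
  have hq : (p.comp (Polynomial.X - Polynomial.C 1)).natDegree = l := by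
    rw [Polynomial.natDegree_comp, Polynomial.natDegree_X_sub_C, hpl, mul_one]
  refine ⟨p.comp (Polynomial.X - Polynomial.C 1), ?_, fun n hn => ?_⟩
  · rw [Polynomial.degree_eq_iff_natDegree_eq_of_pos (by lia), hq]
  · obtain ⟨d, rfl⟩ : ∃ d, n = d + 1 := ⟨n - 1, by lia⟩
    rw [sigmaVol_eq hk hkl hn rfl]
    refine (hpe d).trans ?_
    simp
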